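/- Fix m ∈ ℕ, α₀ > 0 and α₁,…,α_m ≥ 0, let n > m + 1, and let f : [0,1] → ℝ satisfy Σ_{j=0}^{2^k−1} (ϑ^f_{k,j})² > 0 for every k ∈ {n−m−1, …, n}. Then the sequential scale estimator is scale-invariant: for every λ > 0, 𝓡^s_n(λ f) = 𝓡^s_n(f). -/

import Mathlib

open MeasureTheory ProbabilityTheory Filter

/-- Approximated Faber–Schauder coefficient `ϑ^f_{n,k}`. -/
noncomputable def vartheta (f : ℝ → ℝ) (n k : ℕ) : ℝ :=
  (2 : ℝ) ^ ((3 * (n : ℝ)) / 2 + 3) *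
    (f ((4 * k) / 2 ^ (n + 2)) - 2 * f ((4 * k + 1) / 2 ^ (n + 2))
      + 2 * f ((4 * k + 3) / 2 ^ (n + 2)) - f ((4 * k + 4) / 2 ^ (n + 2)))

/-- The estimator `𝓡̂_n(f) = 1 - (1/n) log₂ √(Σ_k (ϑ^f_{n,k})²)`. -/
noncomputable def Rhat (n : ℕ) (f : ℝ → ℝ) : ℝ :=
  1 - (1 / (n : ℝ)) * Real.logb 2 (Real.sqrt (∑ k ∈ Finset.range (2 ^ n), (vartheta f n k) ^ 2))

theorem vartheta_const_mul (c : ℝ) (f : ℝ → ℝ) (n k : ℕ) :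
    vartheta (fun t => c * f t) n k = c * vartheta f n k := by
  unfold vartheta
  ring

/-- Multiplying `f` by `2 ^ x` shifts `𝓡̂_n(f)` by `-x / n`. -/
theorem Rhat_two_rpow_mul (n : ℕ) (f : ℝ → ℝ) (x : ℝ)
    (hf : 0 < ∑ k ∈ Finset.range (2 ^ n), (vartheta f n k) ^ 2) :
    Rhat n (fun t => (2 : ℝ) ^ x * f t) = Rhat n f - 1 / (n : ℝ) * x := by
  have h2 : (0 : ℝ) < 2 ^ x := Real.rpow_pos_of_pos two_pos x
  have hlog : Real.logb 2 ((2 : ℝ) ^ x) = x := Real.logb_rpow two_pos (by norm_num)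
  simp only [Rhat, vartheta_const_mul, mul_pow, ← Finset.mul_sum]
  rw [Real.sqrt_mul (sq_nonneg _), Real.sqrt_sq h2.le,
    Real.logb_mul h2.ne' (Real.sqrt_pos.2 hf).ne', hlog]
  ring

/-- A weighted least-squares problem in one variable has at most one minimizer, provided some
term with positive weight depends on the variable. -/
theorem eq_of_isMin_sum_sq {ι : Type*} (s : Finset ι) (w d c : ι → ℝ)
    (hw : ∀ i ∈ s, 0 ≤ w i) {i₀ : ι} (hi₀ : i₀ ∈ s) (hw₀ : 0 < w i₀) (hc₀ : c i₀ ≠ 0) {x y : ℝ}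
    (hx : ∀ z, ∑ i ∈ s, w i * (d i + c i * x) ^ 2 ≤ ∑ i ∈ s, w i * (d i + c i * z) ^ 2)
    (hy : ∀ z, ∑ i ∈ s, w i * (d i + c i * y) ^ 2 ≤ ∑ i ∈ s, w i * (d i + c i * z) ^ 2) :
    x = y := by
  have key : ∑ i ∈ s, w i * (c i * (x - y)) ^ 2 =
      2 * ∑ i ∈ s, w i * (d i + c i * x) ^ 2 + 2 * ∑ i ∈ s, w i * (d i + c i * y) ^ 2
        - 4 * ∑ i ∈ s, w i * (d i + c i * ((x + y) / 2)) ^ 2 := by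
    simp only [Finset.mul_sum, ← Finset.sum_add_distrib, ← Finset.sum_sub_distrib]
    exact Finset.sum_congr rfl fun i _ => by ring
  have hle : w i₀ * (c i₀ * (x - y)) ^ 2 ≤ ∑ i ∈ s, w i * (c i * (x - y)) ^ 2 :=
    Finset.single_le_sum (f := fun i => w i * (c i * (x - y)) ^ 2)
      (fun i hi => mul_nonneg (hw i hi) (sq_nonneg _)) hi₀
  by_contra hne
  have hlt : 0 < w i₀ * (c i₀ * (x - y)) ^ 2 :=
    mul_pos hw₀ (sq_pos_of_ne_zero (mul_ne_zero hc₀ (sub_ne_zero.2 hne)))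
  linarith [hx ((x + y) / 2), hy ((x + y) / 2)]

/-- Scale-invariance of the sequential scale estimator: if `η₁` is the sequential scaling
factor for `f` and `η₂` the one for `λf`, then `𝓡^s_n(λf) = 𝓡̂_n(η₂·λf) = 𝓡̂_n(η₁·f) = 𝓡^s_n(f)`. -/
theorem stmt15 (m : ℕ) (a : ℕ → ℝ) (ha0 : 0 < a 0) (ha : ∀ j ≤ m, 0 ≤ a j)
    (n : ℕ) (hn : m + 1 < n) (f : ℝ → ℝ)
    (hpos : ∀ k : ℕ, n - m - 1 ≤ k → k ≤ n →
      0 < ∑ j ∈ Finset.range (2 ^ k), (vartheta f k j) ^ 2)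
    (l : ℝ) (hl : 0 < l) (η₁ η₂ : ℝ) (hη₁ : 0 < η₁) (hη₂ : 0 < η₂)
    (hmin₁ : ∀ η : ℝ, 0 < η →
      (∑ k ∈ Finset.Icc (n - m) n, a (n - k) *
          (Rhat k (fun t => η₁ * f t) - Rhat (k - 1) (fun t => η₁ * f t)) ^ 2) ≤
        (∑ k ∈ Finset.Icc (n - m) n, a (n - k) *
          (Rhat k (fun t => η * f t) - Rhat (k - 1) (fun t => η * f t)) ^ 2))
    (hmin₂ : ∀ η : ℝ, 0 < η →
      (∑ k ∈ Finset.Icc (n - m) n, a (n - k) *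
          (Rhat k (fun t => η₂ * (l * f t)) - Rhat (k - 1) (fun t => η₂ * (l * f t))) ^ 2) ≤
        (∑ k ∈ Finset.Icc (n - m) n, a (n - k) *
          (Rhat k (fun t => η * (l * f t)) - Rhat (k - 1) (fun t => η * (l * f t))) ^ 2)) :
    Rhat n (fun t => η₂ * (l * f t)) = Rhat n (fun t => η₁ * f t) := by
  have hassoc : ∀ η : ℝ, (fun t => η * (l * f t)) = fun t => η * l * f t :=
    fun η => funext fun t => (mul_assoc η l (f t)).symm
  simp only [hassoc] at hmin₂ ⊢
  have hrpow : ∀ η : ℝ, 0 < η → (2 : ℝ) ^ Real.logb 2 η = η := fun η hη =>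
    Real.rpow_logb two_pos (by norm_num) hη
  have hsum : ∀ x : ℝ, (∑ k ∈ Finset.Icc (n - m) n, a (n - k) *
      (Rhat k (fun t => (2 : ℝ) ^ x * f t) - Rhat (k - 1) (fun t => (2 : ℝ) ^ x * f t)) ^ 2) =
      ∑ k ∈ Finset.Icc (n - m) n, a (n - k) * ((Rhat k f - Rhat (k - 1) f) +
        (1 / ((k - 1 : ℕ) : ℝ) - 1 / (k : ℝ)) * x) ^ 2 := by
    refine fun x => Finset.sum_congr rfl fun k hk => ?_
    rw [Finset.mem_Icc] at hk
    rw [Rhat_two_rpow_mul k f x (hpos k (by omega) (by omega)),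
      Rhat_two_rpow_mul (k - 1) f x (hpos (k - 1) (by omega) (by omega))]
    ring
  have hcoef : 1 / ((n - 1 : ℕ) : ℝ) - 1 / (n : ℝ) ≠ 0 := by
    have h1 : (0 : ℝ) < ((n - 1 : ℕ) : ℝ) := by exact_mod_cast (by omega : 0 < n - 1)
    have h2 : ((n - 1 : ℕ) : ℝ) < n := by exact_mod_cast (by omega : n - 1 < n)
    exact (sub_pos.2 (one_div_lt_one_div_of_lt h1 h2)).ne'
  have hlog : Real.logb 2 (η₂ * l) = Real.logb 2 η₁ := by
    refine eq_of_isMin_sum_sq (Finset.Icc (n - m) n) (fun k => a (n - k))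
      (fun k => Rhat k f - Rhat (k - 1) f)
      (fun k => 1 / ((k - 1 : ℕ) : ℝ) - 1 / (k : ℝ)) (i₀ := n)
      (fun k hk => ha _ (by rw [Finset.mem_Icc] at hk; omega))
      (Finset.mem_Icc.2 ⟨Nat.sub_le n m, le_rfl⟩) (by simpa using ha0) hcoef
      (fun z => ?_) (fun z => ?_)
    · rw [← hsum, ← hsum, hrpow _ (mul_pos hη₂ hl)]
      simpa only [div_mul_cancel₀ _ hl.ne'] using
        hmin₂ ((2 : ℝ) ^ z / l) (div_pos (Real.rpow_pos_of_pos two_pos z) hl)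
    · rw [← hsum, ← hsum, hrpow _ hη₁]
      exact hmin₁ _ (Real.rpow_pos_of_pos two_pos z)
  rw [← hrpow _ (mul_pos hη₂ hl), hlog, hrpow _ hη₁]
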